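/- Fix n, u, c, m : ℕ and e := u + c. Let N a : Matrix (Fin e) (Fin u) ℝ for a ∈ Fin (n+1), C0 : Matrix (Fin c) (Fin e) ℝ, and M a : Matrix (Fin m) (Fin c) ℝ for a ∈ Fin (n+1). Assume: (i) C0 * (N 0) = 0; (ii) the symmetrized relation (M a) * C0 * (N b) + (M b) * C0 * (N a) = 0 holds for all a, b; (iii) the system has no algebraic constraints, i.e. for every x : Fin e → ℝ, if x ᵥ* (N a) = 0 for all a then x = 0; (iv) C0 has trivial left kernel (y ᵥ* C0 = 0 implies y = 0). Then M 0 = 0. -/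

import Mathlib

open Matrix

/-- The time component of every extra Geroch field `M` vanishes. -/
theorem stmt_2 (n u c m : ℕ)
    (N : Fin (n + 1) → Matrix (Fin (u + c)) (Fin u) ℝ)
    (C0 : Matrix (Fin c) (Fin (u + c)) ℝ)
    (M : Fin (n + 1) → Matrix (Fin m) (Fin c) ℝ)
    (hCN : C0 * N 0 = 0)
    (hsym : ∀ a b, M a * C0 * N b + M b * C0 * N a = 0)
    (hnoalg : ∀ x : Fin (u + c) → ℝ, (∀ a, x ᵥ* N a = 0) → x = 0)
    (hker : ∀ y : Fin c → ℝ, y ᵥ* C0 = 0 → y = 0) :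
    M 0 = 0 := by
  have hMN : ∀ b, M 0 * C0 * N b = 0 := fun b => by
    simpa [Matrix.mul_assoc, hCN] using hsym 0 b
  ext i j
  refine congrFun (hker (M 0 i) (hnoalg _ fun b => ?_)) j
  ext k
  exact congrFun (congrFun (hMN b) i) k
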